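/- Let H be a weak Hopf algebra over a commutative ring k whose antipode λ_H is bijective, and let A_H ↪ A be an H-cleft extension with cleaving morphism f (with convolution inverse f^{-1}). Then h = μ_A∘(f⊗(f^{-1}∘η_H)): H→A is a total integral. If moreover H is cocommutative, then h is convolution invertible with convolution inverse h^{-1} = μ_A∘((f∘η_H)⊗f^{-1}). -/

import Mathlib

open TensorProduct

noncomputable section

namespace WHA

variable (k : Type) [CommRing k]

/-- Generalized convolution product of two linear maps from a "coalgebra"
(given by a comultiplication `δC`) to a module `P` with a product `m`. -/
def convG {C P : Type} [AddCommGroup C] [Module k C] [AddCommGroup P] [Module k P]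
    (δC : C →ₗ[k] C ⊗[k] C) (m : P ⊗[k] P →ₗ[k] P) (f g : C →ₗ[k] P) : C →ₗ[k] P :=
  m ∘ₗ TensorProduct.map f g ∘ₗ δC

/-- Convolution product of two linear maps from a "coalgebra" to an algebra. -/
def conv {C A : Type} [AddCommGroup C] [Module k C] [Ring A] [Algebra k A]
    (δC : C →ₗ[k] C ⊗[k] C) (f g : C →ₗ[k] A) : C →ₗ[k] A :=
  convG k δC (LinearMap.mul' k A) f g

variable (H : Type) [Ring H] [Algebra k H]

/-- The structure maps (comultiplication, counit, antipode) of a prospective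
weak Hopf algebra on the `k`-algebra `H`. -/
structure HopfData where
  δ : H →ₗ[k] H ⊗[k] H
  ε : H →ₗ[k] k
  lam : H →ₗ[k] H

variable {k H}

/-- The target map `Π^L_H = ((ε∘μ)⊗H)∘(H⊗c)∘((δ∘η)⊗H)`. -/
def PiL (W : HopfData k H) : H →ₗ[k] H :=
  (TensorProduct.rid k H).toLinearMap
    ∘ₗ LinearMap.lTensor H (W.ε ∘ₗ LinearMap.mul' k H)
    ∘ₗ (TensorProduct.assoc k H H H).toLinearMap
    ∘ₗ LinearMap.rTensor H (TensorProduct.comm k H H).toLinearMap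
    ∘ₗ TensorProduct.mk k (H ⊗[k] H) H (W.δ 1)

/-- The source map `Π^R_H = (H⊗(ε∘μ))∘(c⊗H)∘(H⊗(δ∘η))`. -/
def PiR (W : HopfData k H) : H →ₗ[k] H :=
  (TensorProduct.lid k H).toLinearMap
    ∘ₗ LinearMap.rTensor H (W.ε ∘ₗ LinearMap.mul' k H)
    ∘ₗ (TensorProduct.assoc k H H H).symm.toLinearMap
    ∘ₗ LinearMap.lTensor H (TensorProduct.comm k H H).toLinearMap
    ∘ₗ (TensorProduct.mk k H (H ⊗[k] H)).flip (W.δ 1)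

/-- `H` together with the data `W` is a weak Hopf algebra. -/
structure IsWeakHopf (W : HopfData k H) : Prop where
  coassoc : ∀ h : H,
    (TensorProduct.assoc k H H H) ((LinearMap.rTensor H W.δ) (W.δ h)) =
      (LinearMap.lTensor H W.δ) (W.δ h)
  counit_left : ∀ h : H, (TensorProduct.lid k H) ((LinearMap.rTensor H W.ε) (W.δ h)) = h
  counit_right : ∀ h : H, (TensorProduct.rid k H) ((LinearMap.lTensor H W.ε) (W.δ h)) = h
  a1 : ∀ x y : H, W.δ (x * y) = W.δ x * W.δ y
  a2 : ∀ x y z : H, W.ε (x * y * z) =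
    LinearMap.mul' k k ((TensorProduct.map (W.ε ∘ₗ LinearMap.mulLeft k x)
      (W.ε ∘ₗ LinearMap.mulRight k z)) (W.δ y))
  a2' : ∀ x y z : H, W.ε (x * y * z) =
    LinearMap.mul' k k ((TensorProduct.map (W.ε ∘ₗ LinearMap.mulLeft k x)
      (W.ε ∘ₗ LinearMap.mulRight k z)) ((TensorProduct.comm k H H) (W.δ y)))
  a3 : (TensorProduct.assoc k H H H) ((LinearMap.rTensor H W.δ) (W.δ 1)) =
    (TensorProduct.map LinearMap.id
        (Algebra.TensorProduct.includeLeft : H →ₐ[k] H ⊗[k] H).toLinearMap) (W.δ 1) *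
      (Algebra.TensorProduct.includeRight : (H ⊗[k] H) →ₐ[k] H ⊗[k] (H ⊗[k] H)).toLinearMap
        (W.δ 1)
  a3' : (TensorProduct.assoc k H H H) ((LinearMap.rTensor H W.δ) (W.δ 1)) =
    (Algebra.TensorProduct.includeRight : (H ⊗[k] H) →ₐ[k] H ⊗[k] (H ⊗[k] H)).toLinearMap
        (W.δ 1) *
      (TensorProduct.map LinearMap.id
        (Algebra.TensorProduct.includeLeft : H →ₐ[k] H ⊗[k] H).toLinearMap) (W.δ 1)
  a4_left : ∀ h : H,
    LinearMap.mul' k H ((TensorProduct.map LinearMap.id W.lam) (W.δ h)) = PiL W h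
  a4_right : ∀ h : H,
    LinearMap.mul' k H ((TensorProduct.map W.lam LinearMap.id) (W.δ h)) = PiR W h
  a4_mid : conv k W.δ (conv k W.δ W.lam LinearMap.id) W.lam = W.lam

/-- `H` is cocommutative. -/
def Cocomm (W : HopfData k H) : Prop :=
  ∀ h : H, (TensorProduct.comm k H H) (W.δ h) = W.δ h

section ComodAlg

variable {A : Type} [Ring A] [Algebra k A]

/-- The map `ζ_A = (μ_A⊗H)∘(A⊗c_{H,A})∘((ρ_A∘η_A)⊗A)`; in the tensor product
algebra `A ⊗ H` it is given by `a ↦ ρ(1) * (a ⊗ 1)`. -/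
def zeta (ρ : A →ₗ[k] A ⊗[k] H) (a : A) : A ⊗[k] H :=
  ρ 1 * (a ⊗ₜ[k] (1 : H))

/-- `a` is a coinvariant element, i.e. belongs to `A_H`. -/
def IsCoinv (ρ : A →ₗ[k] A ⊗[k] H) (a : A) : Prop :=
  ρ a = zeta ρ a

/-- `(A, ρ)` is a right `H`-comodule algebra. -/
structure IsComodAlg (W : HopfData k H) (ρ : A →ₗ[k] A ⊗[k] H) : Prop where
  coassoc : ∀ a : A, (TensorProduct.assoc k A H H) ((LinearMap.rTensor H ρ) (ρ a)) =
    (LinearMap.lTensor A W.δ) (ρ a)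
  counit : ∀ a : A, (TensorProduct.rid k A) ((LinearMap.lTensor A W.ε) (ρ a)) = a
  mul_compat : ∀ a b : A, ρ (a * b) = ρ a * ρ b
  unit_coinv : (LinearMap.lTensor A (PiL W)) (ρ 1) = ρ 1

end ComodAlg

/-- For `t = Σ x ⊗ y : B ⊗ H`, the map `h ↦ Σ ε(h*y) • x`.  For
`t = ρ(1)` this is the map `e_A = (A⊗ε)∘Γ∘(H⊗η)`. -/
def eGen (W : HopfData k H) {B : Type} [AddCommGroup B] [Module k B]
    (t : B ⊗[k] H) : H →ₗ[k] B :=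
  (TensorProduct.lid k B).toLinearMap
    ∘ₗ LinearMap.rTensor B (W.ε ∘ₗ LinearMap.mul' k H)
    ∘ₗ (TensorProduct.assoc k H H B).symm.toLinearMap
    ∘ₗ LinearMap.lTensor H (TensorProduct.comm k B H).toLinearMap
    ∘ₗ (TensorProduct.mk k H (B ⊗[k] H)).flip t

/-- For `t = Σ x ⊗ y : B ⊗ H`, the map `h ↦ Σ ε(y*h) • x`.  For
`t = ρ(1)` this is the map `(A⊗(ε∘μ))∘((ρ∘η)⊗H)`. -/
def dGen (W : HopfData k H) {B : Type} [AddCommGroup B] [Module k B]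
    (t : B ⊗[k] H) : H →ₗ[k] B :=
  (TensorProduct.rid k B).toLinearMap
    ∘ₗ LinearMap.lTensor B (W.ε ∘ₗ LinearMap.mul' k H)
    ∘ₗ (TensorProduct.assoc k B H H).toLinearMap
    ∘ₗ TensorProduct.mk k (B ⊗[k] H) H t

section ComodAlg2

variable {A : Type} [Ring A] [Algebra k A]

/-- The entwining map `Γ_A^H = (A⊗μ_H)∘(c_{H,A}⊗H)∘(H⊗ρ_A)`. -/
def Γmap (ρ : A →ₗ[k] A ⊗[k] H) : H ⊗[k] A →ₗ[k] A ⊗[k] H :=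
  LinearMap.lTensor A (LinearMap.mul' k H)
    ∘ₗ (TensorProduct.assoc k A H H).toLinearMap
    ∘ₗ LinearMap.rTensor H (TensorProduct.comm k H A).toLinearMap
    ∘ₗ (TensorProduct.assoc k H A H).symm.toLinearMap
    ∘ₗ LinearMap.lTensor H ρ

/-- `f : H → A` is an integral, i.e. a morphism of right `H`-comodules. -/
def IsIntegral (W : HopfData k H) (ρ : A →ₗ[k] A ⊗[k] H) (f : H →ₗ[k] A) : Prop :=
  ∀ h : H, ρ (f h) = (LinearMap.rTensor H f) (W.δ h)

/-- `finv` is the convolution inverse of the integral `f` (conditions (c1)-(c3)). -/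
def IsConvInv (W : HopfData k H) (ρ : A →ₗ[k] A ⊗[k] H) (f finv : H →ₗ[k] A) : Prop :=
  conv k W.δ finv f = eGen W (ρ 1) ∧
  conv k W.δ f finv = dGen W (ρ 1) ∧
  conv k W.δ (conv k W.δ finv f) finv = finv

/-- `f` is a cleaving morphism (with convolution inverse `finv`) for the extension
`A_H ↪ A`, i.e. a convolution invertible integral such that `f ∧ f⁻¹` takes
values in the coinvariants. -/
def IsCleaving (W : HopfData k H) (ρ : A →ₗ[k] A ⊗[k] H) (f finv : H →ₗ[k] A) : Prop :=
  IsIntegral W ρ f ∧ IsConvInv W ρ f finv ∧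
    ∀ h : H, IsCoinv ρ (conv k W.δ f finv h)

end ComodAlg2

section ModAlg

variable {B : Type} [Ring B] [Algebra k B]

/-- `u₁ = φ ∘ (H ⊗ η_B)`. -/
def u1 (φ : H ⊗[k] B →ₗ[k] B) : H →ₗ[k] B :=
  φ ∘ₗ (TensorProduct.mk k H B).flip 1

/-- `u₂ = u₁ ∘ μ_H`. -/
def u2 (φ : H ⊗[k] B →ₗ[k] B) : H ⊗[k] H →ₗ[k] B :=
  u1 φ ∘ₗ LinearMap.mul' k H

/-- `(B, φ)` is a weak left `H`-module algebra (conditions (d1)-(d4)). -/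
def IsWeakModAlg (W : HopfData k H) (φ : H ⊗[k] B →ₗ[k] B) : Prop :=
  (∀ b : B, φ ((1 : H) ⊗ₜ[k] b) = b) ∧
  (∀ (h : H) (b c : B), φ (h ⊗ₜ[k] (b * c)) =
    LinearMap.mul' k B ((TensorProduct.map (φ ∘ₗ (TensorProduct.mk k H B).flip b)
      (φ ∘ₗ (TensorProduct.mk k H B).flip c)) (W.δ h))) ∧
  (∀ g h : H, φ ((g * h) ⊗ₜ[k] (1 : B)) = φ (g ⊗ₜ[k] φ (h ⊗ₜ[k] (1 : B)))) ∧
  (∀ (h : H) (b : B), φ (PiL W h ⊗ₜ[k] b) = φ (h ⊗ₜ[k] (1 : B)) * b)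

/-- `(B, φ)` is a left `H`-module algebra. -/
def IsModAlg (W : HopfData k H) (φ : H ⊗[k] B →ₗ[k] B) : Prop :=
  IsWeakModAlg W φ ∧
    ∀ (g h : H) (b : B), φ ((g * h) ⊗ₜ[k] b) = φ (g ⊗ₜ[k] φ (h ⊗ₜ[k] b))

/-- `(h, hinv)` is a pair of mutually convolution inverse elements in
`Reg_{φ}(H,B)`. -/
def IsRegPair (W : HopfData k H) (φ : H ⊗[k] B →ₗ[k] B) (h hinv : H →ₗ[k] B) : Prop :=
  conv k W.δ h hinv = u1 φ ∧ conv k W.δ hinv h = u1 φ ∧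
  conv k W.δ (conv k W.δ h hinv) h = h ∧
  conv k W.δ (conv k W.δ hinv h) hinv = hinv

end ModAlg

/-- The comultiplication of the tensor product coalgebra `H ⊗ H`. -/
def δ2 (W : HopfData k H) : H ⊗[k] H →ₗ[k] (H ⊗[k] H) ⊗[k] (H ⊗[k] H) :=
  (TensorProduct.tensorTensorTensorComm k H H H H).toLinearMap
    ∘ₗ TensorProduct.map W.δ W.δ

/-- The comultiplication of the tensor product coalgebra `H ⊗ (H ⊗ H)`. -/
def δ3 (W : HopfData k H) :
    H ⊗[k] (H ⊗[k] H) →ₗ[k] (H ⊗[k] (H ⊗[k] H)) ⊗[k] (H ⊗[k] (H ⊗[k] H)) :=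
  (TensorProduct.tensorTensorTensorComm k H H (H ⊗[k] H) (H ⊗[k] H)).toLinearMap
    ∘ₗ TensorProduct.map W.δ (δ2 W)

section ModAlg2

variable {B : Type} [Ring B] [Algebra k B]

/-- `(σ, σinv)` is a pair of mutually convolution inverse elements in
`Reg_{φ}(H⊗H,B)`. -/
def IsRegPair2 (W : HopfData k H) (φ : H ⊗[k] B →ₗ[k] B)
    (σ σinv : H ⊗[k] H →ₗ[k] B) : Prop :=
  conv k (δ2 W) σ σinv = u2 φ ∧ conv k (δ2 W) σinv σ = u2 φ ∧
  conv k (δ2 W) (conv k (δ2 W) σ σinv) σ = σ ∧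
  conv k (δ2 W) (conv k (δ2 W) σinv σ) σinv = σinv

/-- Condition (g1) (the twisted condition). -/
def CrossedG1 (W : HopfData k H) (φ : H ⊗[k] B →ₗ[k] B) (σ : H ⊗[k] H →ₗ[k] B) : Prop :=
  ∀ (x y : H) (b : B),
    LinearMap.mul' k B ((TensorProduct.map σ
        ((φ ∘ₗ (TensorProduct.mk k H B).flip b) ∘ₗ LinearMap.mul' k H))
      (δ2 W (x ⊗ₜ[k] y))) =
    LinearMap.mul' k B ((TensorProduct.map
        (φ ∘ₗ LinearMap.lTensor H (φ ∘ₗ (TensorProduct.mk k H B).flip b)) σ)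
      (δ2 W (x ⊗ₜ[k] y)))

/-- Condition (g2) (the cocycle condition). -/
def CrossedG2 (W : HopfData k H) (φ : H ⊗[k] B →ₗ[k] B) (σ : H ⊗[k] H →ₗ[k] B) : Prop :=
  conv k (δ3 W) (φ ∘ₗ LinearMap.lTensor H σ)
      (σ ∘ₗ LinearMap.lTensor H (LinearMap.mul' k H)) =
  conv k (δ3 W)
      ((TensorProduct.rid k B).toLinearMap ∘ₗ TensorProduct.map σ W.ε
        ∘ₗ (TensorProduct.assoc k H H H).symm.toLinearMap)
      (σ ∘ₗ LinearMap.rTensor H (LinearMap.mul' k H)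
        ∘ₗ (TensorProduct.assoc k H H H).symm.toLinearMap)

/-- Condition (g3) (the normal condition). -/
def CrossedG3 (W : HopfData k H) (φ : H ⊗[k] B →ₗ[k] B) (σ : H ⊗[k] H →ₗ[k] B) : Prop :=
  ∀ h : H, σ (h ⊗ₜ[k] (1 : H)) = u1 φ h ∧ σ ((1 : H) ⊗ₜ[k] h) = u1 φ h

/-- `(φ, σ)` is a crossed system for `H` over `B`, with `σinv` the convolution
inverse of `σ`. -/
def IsCrossedSystem (W : HopfData k H) (φ : H ⊗[k] B →ₗ[k] B)
    (σ σinv : H ⊗[k] H →ₗ[k] B) : Prop :=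
  IsWeakModAlg W φ ∧ IsRegPair2 W φ σ σinv ∧
    CrossedG1 W φ σ ∧ CrossedG2 W φ σ ∧ CrossedG3 W φ σ

/-- The condition that `h` conjugates the weak action `ϕ` into `φ`. -/
def FisEq (W : HopfData k H) (φ ϕ : H ⊗[k] B →ₗ[k] B) (h hinv : H →ₗ[k] B) : Prop :=
  ∀ (g : H) (b : B), φ (g ⊗ₜ[k] b) =
    (LinearMap.mul' k B ∘ₗ LinearMap.rTensor B (LinearMap.mul' k B))
      ((TensorProduct.map (TensorProduct.map h (ϕ ∘ₗ (TensorProduct.mk k H B).flip b)) hinv)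
        ((LinearMap.rTensor H W.δ) (W.δ g)))

/-- The condition that `h` transforms the cocycle `τ` into `σ`. -/
def SigmasEq (W : HopfData k H) (ϕ : H ⊗[k] B →ₗ[k] B)
    (σ τ : H ⊗[k] H →ₗ[k] B) (h hinv : H →ₗ[k] B) : Prop :=
  σ = conv k (δ2 W)
    (LinearMap.mul' k B ∘ₗ TensorProduct.map h ϕ
      ∘ₗ (TensorProduct.assoc k H H B).toLinearMap ∘ₗ TensorProduct.map W.δ h)
    (conv k (δ2 W) τ (hinv ∘ₗ LinearMap.mul' k H))

/-- `h` (with convolution inverse `hinv`) realizes an equivalence between the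
crossed systems `(φ, σ)` and `(ϕ, τ)`. -/
def RealizesEquiv (W : HopfData k H) (φ ϕ : H ⊗[k] B →ₗ[k] B)
    (σ τ : H ⊗[k] H →ₗ[k] B) (h hinv : H →ₗ[k] B) : Prop :=
  IsRegPair W φ h hinv ∧ IsRegPair W ϕ h hinv ∧ h 1 = 1 ∧
    FisEq W φ ϕ h hinv ∧ SigmasEq W ϕ σ τ h hinv

/-- The crossed systems `(φ, σ)` and `(ϕ, τ)` are equivalent. -/
def CrossedEquiv (W : HopfData k H) (φ ϕ : H ⊗[k] B →ₗ[k] B)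
    (σ τ : H ⊗[k] H →ₗ[k] B) : Prop :=
  u1 φ = u1 ϕ ∧ ∃ h hinv : H →ₗ[k] B, RealizesEquiv W φ ϕ σ τ h hinv

/-- The map `ψ_H^B = (φ⊗H)∘(H⊗c_{H,B})∘(δ_H⊗B)`. -/
def ψmap (W : HopfData k H) (φ : H ⊗[k] B →ₗ[k] B) : H ⊗[k] B →ₗ[k] B ⊗[k] H :=
  LinearMap.rTensor H φ
    ∘ₗ (TensorProduct.assoc k H B H).symm.toLinearMap
    ∘ₗ LinearMap.lTensor H (TensorProduct.comm k H B).toLinearMap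
    ∘ₗ (TensorProduct.assoc k H H B).toLinearMap
    ∘ₗ LinearMap.rTensor B W.δ

/-- The map `σ_H^B = (σ⊗μ_H)∘δ_{H⊗H}`. -/
def σHA (W : HopfData k H) (σ : H ⊗[k] H →ₗ[k] B) : H ⊗[k] H →ₗ[k] B ⊗[k] H :=
  TensorProduct.map σ (LinearMap.mul' k H) ∘ₗ δ2 W

/-- The idempotent `∇_{B⊗H} = (μ_B⊗H)∘(B⊗ψ_H^B)∘(B⊗H⊗η_B)`. -/
def nabla (W : HopfData k H) (φ : H ⊗[k] B →ₗ[k] B) : B ⊗[k] H →ₗ[k] B ⊗[k] H :=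
  LinearMap.rTensor H (LinearMap.mul' k B)
    ∘ₗ (TensorProduct.assoc k B B H).symm.toLinearMap
    ∘ₗ LinearMap.lTensor B (ψmap W φ)
    ∘ₗ LinearMap.lTensor B ((TensorProduct.mk k H B).flip 1)

/-- The product `(μ_B⊗H)∘(μ_B⊗σ_H^B)∘(B⊗ψ_H^B⊗H)` on `B ⊗ H`. -/
def crossmulAmb (W : HopfData k H) (φ : H ⊗[k] B →ₗ[k] B) (σ : H ⊗[k] H →ₗ[k] B) :
    (B ⊗[k] H) ⊗[k] (B ⊗[k] H) →ₗ[k] B ⊗[k] H :=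
  LinearMap.rTensor H (LinearMap.mul' k B)
    ∘ₗ (TensorProduct.assoc k B B H).symm.toLinearMap
    ∘ₗ LinearMap.lTensor B (LinearMap.rTensor H (LinearMap.mul' k B))
    ∘ₗ LinearMap.lTensor B ((TensorProduct.assoc k B B H).symm.toLinearMap)
    ∘ₗ LinearMap.lTensor B (LinearMap.lTensor B (σHA W σ))
    ∘ₗ LinearMap.lTensor B ((TensorProduct.assoc k B H H).toLinearMap)
    ∘ₗ LinearMap.lTensor B (LinearMap.rTensor H (ψmap W φ))
    ∘ₗ LinearMap.lTensor B ((TensorProduct.assoc k H B H).symm.toLinearMap)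
    ∘ₗ (TensorProduct.assoc k B H (B ⊗[k] H)).toLinearMap

end ModAlg2

section CrossProd

variable {B : Type} [Ring B] [Algebra k B]
variable {P : Type} [AddCommGroup P] [Module k P]

/-- The product of the weak crossed product `B ×_σ H`, through a splitting
`(P, p, ι)` of the idempotent `∇_{B⊗H}`. -/
def crossMul (W : HopfData k H) (φ : H ⊗[k] B →ₗ[k] B) (σ : H ⊗[k] H →ₗ[k] B)
    (p : B ⊗[k] H →ₗ[k] P) (ι : P →ₗ[k] B ⊗[k] H) : P ⊗[k] P →ₗ[k] P :=
  p ∘ₗ crossmulAmb W φ σ ∘ₗ TensorProduct.map ι ι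

/-- The unit of the weak crossed product `B ×_σ H`. -/
def crossUnit (W : HopfData k H) (φ : H ⊗[k] B →ₗ[k] B)
    (p : B ⊗[k] H →ₗ[k] P) : P :=
  p (nabla W φ ((1 : B) ⊗ₜ[k] (1 : H)))

/-- The coaction `ρ_{B×H} = (p⊗H)∘(B⊗δ_H)∘ι` of the weak crossed product. -/
def crossCoact (W : HopfData k H)
    (p : B ⊗[k] H →ₗ[k] P) (ι : P →ₗ[k] B ⊗[k] H) : P →ₗ[k] P ⊗[k] H :=
  LinearMap.rTensor H p ∘ₗ (TensorProduct.assoc k B H H).symm.toLinearMap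
    ∘ₗ LinearMap.lTensor B W.δ ∘ₗ ι

/-- The inclusion `i_{B×H} = p∘(B⊗η_H) : B → B × H`. -/
def crossInc (p : B ⊗[k] H →ₗ[k] P) : B →ₗ[k] P :=
  p ∘ₗ (TensorProduct.mk k B H).flip 1

/-- The analogue of `ζ` for an abstract module `P` with product `m`:
`ζ(x) = t · (x ⊗ 1)` where `t` plays the role of `ρ(1)`. -/
def zetaGen (m : P ⊗[k] P →ₗ[k] P) (t : P ⊗[k] H) (x : P) : P ⊗[k] H :=
  (TensorProduct.map m (LinearMap.mul' k H))
    ((TensorProduct.tensorTensorTensorComm k P H P H) (t ⊗ₜ[k] (x ⊗ₜ[k] (1 : H))))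

end CrossProd

section Induced

variable {D P : Type} [AddCommGroup D] [Module k D] [AddCommGroup P] [Module k P]

/-- The map `(P⊗P)⊗P → P`, `(x⊗y)⊗z ↦ x·(z·y)`. -/
def mulSwizG (m : P ⊗[k] P →ₗ[k] P) : (P ⊗[k] P) ⊗[k] P →ₗ[k] P :=
  m ∘ₗ LinearMap.lTensor P (m ∘ₗ (TensorProduct.comm k P P).toLinearMap)
    ∘ₗ (TensorProduct.assoc k P P P).toLinearMap

/-- The ambient weak action `μ∘(P⊗(μ∘c))∘(((f⊗f⁻¹)∘δ_H)⊗j) : H ⊗ D → P`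
induced by a cleaving morphism `f`. -/
def phiAmb (W : HopfData k H) (m : P ⊗[k] P →ₗ[k] P) (f finv : H →ₗ[k] P)
    (j : D →ₗ[k] P) : H ⊗[k] D →ₗ[k] P :=
  mulSwizG m ∘ₗ TensorProduct.map ((TensorProduct.map f finv) ∘ₗ W.δ) j

/-- The ambient cocycle `(μ∘(f⊗f)) ∧ (f⁻¹∘μ_H) : H ⊗ H → P` induced by a
cleaving morphism `f`. -/
def sigmaAmb (W : HopfData k H) (m : P ⊗[k] P →ₗ[k] P) (f finv : H →ₗ[k] P) :
    H ⊗[k] H →ₗ[k] P :=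
  convG k (δ2 W) m (m ∘ₗ TensorProduct.map f f) (finv ∘ₗ LinearMap.mul' k H)

end Induced

section Pres

variable {A D : Type} [Ring A] [Algebra k A] [Ring D] [Algebra k D]

/-- `j : D → A` presents `D` as the subalgebra of coinvariants of `A`. -/
def IsCoinvPres (ρ : A →ₗ[k] A ⊗[k] H) (j : D →ₐ[k] A) : Prop :=
  Function.Injective j ∧ ∀ a : A, IsCoinv ρ a ↔ a ∈ Set.range j

end Pres

section Convolution

variable {A : Type} [Ring A] [Algebra k A]

theorem conv_eq_sum {δC : H →ₗ[k] H ⊗[k] H} (f g : H →ₗ[k] A) {h : H} {ι : Type}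
    {s : Finset ι} {x y : ι → H} (hs : δC h = ∑ i ∈ s, x i ⊗ₜ[k] y i) :
    conv k δC f g h = ∑ i ∈ s, f (x i) * g (y i) := by
  simp [conv, convG, hs]

theorem conv_assoc {W : HopfData k H} (hW : IsWeakHopf W) (f g h : H →ₗ[k] A) :
    conv k W.δ (conv k W.δ f g) h = conv k W.δ f (conv k W.δ g h) := by
  ext x
  have left : ∀ t : H ⊗[k] H,
      LinearMap.mul' k A (TensorProduct.map (conv k W.δ f g) h t) =
        LinearMap.mul' k A (TensorProduct.map f (LinearMap.mul' k A ∘ₗ TensorProduct.map g h)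
          (TensorProduct.assoc k H H H (LinearMap.rTensor H W.δ t))) := by
    intro t
    induction t with
    | zero => simp
    | add a b ha hb => simp [ha, hb]
    | tmul a b =>
      obtain ⟨s, hs⟩ := TensorProduct.exists_finset (W.δ a)
      simp [conv, convG, hs, TensorProduct.sum_tmul, mul_assoc]
  have right : ∀ t : H ⊗[k] H,
      LinearMap.mul' k A (TensorProduct.map f (conv k W.δ g h) t) =
        LinearMap.mul' k A (TensorProduct.map f (LinearMap.mul' k A ∘ₗ TensorProduct.map g h)
          (LinearMap.lTensor H W.δ t)) := by
    intro t
    induction t with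
    | zero => simp
    | add a b ha hb => simp [ha, hb]
    | tmul a b => simp [conv, convG]
  have := left (W.δ x)
  rw [hW.coassoc, ← right] at this
  exact this

theorem mulLeft_comp_conv (δC : H →ₗ[k] H ⊗[k] H) (a : A) (f g : H →ₗ[k] A) :
    conv k δC (LinearMap.mulLeft k a ∘ₗ f) g = LinearMap.mulLeft k a ∘ₗ conv k δC f g := by
  ext x
  obtain ⟨s, hs⟩ := TensorProduct.exists_finset (δC x)
  simp [conv_eq_sum _ _ hs, mul_assoc]

theorem mulRight_comp_conv (δC : H →ₗ[k] H ⊗[k] H) (a : A) (f g : H →ₗ[k] A) :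
    conv k δC f (LinearMap.mulRight k a ∘ₗ g) = LinearMap.mulRight k a ∘ₗ conv k δC f g := by
  ext x
  obtain ⟨s, hs⟩ := TensorProduct.exists_finset (δC x)
  simp [conv_eq_sum _ _ hs, mul_assoc]

/-- Post-composition with a multiplicative linear map is compatible with convolution. -/
theorem comp_conv {B : Type} [Ring B] [Algebra k B] (δC : H →ₗ[k] H ⊗[k] H) (φ : A →ₗ[k] B)
    (hφ : ∀ a b, φ (a * b) = φ a * φ b) (f g : H →ₗ[k] A) :
    conv k δC (φ ∘ₗ f) (φ ∘ₗ g) = φ ∘ₗ conv k δC f g := by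
  ext x
  obtain ⟨s, hs⟩ := TensorProduct.exists_finset (δC x)
  simp [conv_eq_sum _ _ hs, hφ]

end Convolution

section WeakHopf

variable {W : HopfData k H}

theorem PiL_eq_sum {ι : Type} {s : Finset ι} {x y : ι → H}
    (hs : W.δ 1 = ∑ i ∈ s, x i ⊗ₜ[k] y i) (h : H) :
    PiL W h = ∑ i ∈ s, W.ε (x i * h) • y i := by
  simp [PiL, hs]

theorem PiR_eq_sum {ι : Type} {s : Finset ι} {x y : ι → H}
    (hs : W.δ 1 = ∑ i ∈ s, x i ⊗ₜ[k] y i) (h : H) :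
    PiR W h = ∑ i ∈ s, W.ε (h * y i) • x i := by
  simp [PiR, hs]

theorem eGen_eq_sum {B : Type} [AddCommGroup B] [Module k B] {t : B ⊗[k] H} {ι : Type}
    {s : Finset ι} {x : ι → B} {y : ι → H} (hs : t = ∑ i ∈ s, x i ⊗ₜ[k] y i) (h : H) :
    eGen W t h = ∑ i ∈ s, W.ε (h * y i) • x i := by
  simp [eGen, hs]

theorem dGen_eq_sum {B : Type} [AddCommGroup B] [Module k B] {t : B ⊗[k] H} {ι : Type}
    {s : Finset ι} {x : ι → B} {y : ι → H} (hs : t = ∑ i ∈ s, x i ⊗ₜ[k] y i) (h : H) :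
    dGen W t h = ∑ i ∈ s, W.ε (y i * h) • x i := by
  simp [dGen, hs]

/-- The element `z` behaves under `δ` like an element of the image of `Π^L`. -/
structure IsLeftBase (W : HopfData k H) (z : H) : Prop where
  left : W.δ z = (z ⊗ₜ[k] 1) * W.δ 1
  right : W.δ z = W.δ 1 * (z ⊗ₜ[k] 1)

/-- The element `y` behaves under `δ` like an element of the image of `Π^R`. -/
structure IsRightBase (W : HopfData k H) (y : H) : Prop where
  left : W.δ y = (1 ⊗ₜ[k] y) * W.δ 1
  right : W.δ y = W.δ 1 * (1 ⊗ₜ[k] y)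

theorem delta_one_mul (hW : IsWeakHopf W) (h : H) : W.δ 1 * W.δ h = W.δ h := by
  rw [← hW.a1, one_mul]

theorem delta_mul_one (hW : IsWeakHopf W) (h : H) : W.δ h * W.δ 1 = W.δ h := by
  rw [← hW.a1, mul_one]

theorem IsLeftBase.delta_mul (hW : IsWeakHopf W) {z : H} (hz : IsLeftBase W z) (h : H) :
    W.δ (z * h) = (z ⊗ₜ[k] 1) * W.δ h := by
  rw [hW.a1, hz.left, mul_assoc, delta_one_mul hW]

theorem IsLeftBase.delta_mul' (hW : IsWeakHopf W) {z : H} (hz : IsLeftBase W z) (h : H) :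
    W.δ (h * z) = W.δ h * (z ⊗ₜ[k] 1) := by
  rw [hW.a1, hz.right, ← mul_assoc, delta_mul_one hW]

theorem IsRightBase.delta_mul (hW : IsWeakHopf W) {y : H} (hy : IsRightBase W y) (h : H) :
    W.δ (y * h) = (1 ⊗ₜ[k] y) * W.δ h := by
  rw [hW.a1, hy.left, mul_assoc, delta_one_mul hW]

theorem IsRightBase.delta_mul' (hW : IsWeakHopf W) {y : H} (hy : IsRightBase W y) (h : H) :
    W.δ (h * y) = W.δ h * (1 ⊗ₜ[k] y) := by
  rw [hW.a1, hy.right, ← mul_assoc, delta_mul_one hW]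

theorem IsRightBase.commute (hW : IsWeakHopf W) {y z : H} (hy : IsRightBase W y)
    (hz : IsLeftBase W z) : y * z = z * y := by
  have key : W.δ (y * z) = W.δ (z * y) := by
    rw [hy.delta_mul hW, hz.delta_mul hW, hz.left, hy.left, ← mul_assoc, ← mul_assoc]
    simp
  rw [← hW.counit_left (y * z), key, hW.counit_left]

theorem isLeftBase_PiL (hW : IsWeakHopf W) (h : H) : IsLeftBase W (PiL W h) := by
  obtain ⟨s, hs⟩ := TensorProduct.exists_finset (W.δ 1)
  let Φ : H ⊗[k] (H ⊗[k] H) →ₗ[k] H ⊗[k] H :=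
    (TensorProduct.lid k _).toLinearMap ∘ₗ
      LinearMap.rTensor _ (W.ε ∘ₗ LinearMap.mulRight k h)
  have hl : W.δ (PiL W h) =
      Φ (TensorProduct.assoc k H H H (LinearMap.rTensor H W.δ (W.δ 1))) := by
    rw [hW.coassoc]
    simp [Φ, PiL_eq_sum hs, hs]
  constructor
  · rw [hl, hW.a3, PiL_eq_sum hs]
    simp [Φ, hs, TensorProduct.sum_tmul, Finset.sum_mul, Finset.mul_sum,
      TensorProduct.smul_tmul']
  · rw [hl, hW.a3', PiL_eq_sum hs]
    simp [Φ, hs, TensorProduct.sum_tmul, Finset.sum_mul, Finset.mul_sum,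
      TensorProduct.smul_tmul']

theorem isRightBase_PiR (hW : IsWeakHopf W) (h : H) : IsRightBase W (PiR W h) := by
  obtain ⟨s, hs⟩ := TensorProduct.exists_finset (W.δ 1)
  let Φ : H ⊗[k] (H ⊗[k] H) →ₗ[k] H ⊗[k] H :=
    LinearMap.lTensor H ((TensorProduct.rid k _).toLinearMap ∘ₗ
      LinearMap.lTensor _ (W.ε ∘ₗ LinearMap.mulLeft k h))
  have formal : ∀ t : H ⊗[k] H, ∀ x : H, Φ (TensorProduct.assoc k H H H (t ⊗ₜ[k] x)) =
      W.ε (h * x) • t := by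
    intro t x
    induction t with
    | zero => simp
    | add a b ha hb => simp only [TensorProduct.add_tmul, map_add, ha, hb, smul_add]
    | tmul a b => simp [Φ]
  have hl : W.δ (PiR W h) =
      Φ (TensorProduct.assoc k H H H (LinearMap.rTensor H W.δ (W.δ 1))) := by
    simp [PiR_eq_sum hs]
    conv_rhs => rw [hs]
    simp [formal]
  constructor
  · rw [hl, hW.a3', PiR_eq_sum hs]
    simp [Φ, hs, TensorProduct.tmul_sum, Finset.sum_mul, Finset.mul_sum,
      TensorProduct.tmul_smul]
  · rw [hl, hW.a3, PiR_eq_sum hs]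
    simp [Φ, hs, TensorProduct.tmul_sum, Finset.sum_mul, Finset.mul_sum, Finset.smul_sum,
      TensorProduct.tmul_smul]

theorem lTensor_PiL_delta_one (hW : IsWeakHopf W) :
    LinearMap.lTensor H (PiL W) (W.δ 1) = W.δ 1 := by
  obtain ⟨s, hs⟩ := TensorProduct.exists_finset (W.δ 1)
  let Φ : H ⊗[k] (H ⊗[k] H) →ₗ[k] H ⊗[k] H :=
    LinearMap.lTensor H ((TensorProduct.lid k _).toLinearMap ∘ₗ LinearMap.rTensor _ W.ε)
  have hΦ := congrArg Φ (hW.coassoc 1)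
  have hr : Φ (LinearMap.lTensor H W.δ (W.δ 1)) = W.δ 1 := by
    conv_lhs => rw [hs]
    conv_rhs => rw [hs]
    simp [Φ, hW.counit_left]
  rw [hr, hW.a3'] at hΦ
  refine Eq.trans ?_ hΦ
  rw [hs]
  simp [Φ, PiL_eq_sum hs, TensorProduct.tmul_sum, Finset.sum_mul, Finset.mul_sum]

theorem rTensor_PiR_delta_one (hW : IsWeakHopf W) :
    LinearMap.rTensor H (PiR W) (W.δ 1) = W.δ 1 := by
  obtain ⟨s, hs⟩ := TensorProduct.exists_finset (W.δ 1)
  let Φ : H ⊗[k] (H ⊗[k] H) →ₗ[k] H ⊗[k] H :=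
    LinearMap.lTensor H ((TensorProduct.lid k _).toLinearMap ∘ₗ LinearMap.rTensor _ W.ε)
  have hΦ := congrArg Φ (hW.coassoc 1)
  have hr : Φ (LinearMap.lTensor H W.δ (W.δ 1)) = W.δ 1 := by
    conv_lhs => rw [hs]
    conv_rhs => rw [hs]
    simp [Φ, hW.counit_left]
  rw [hr, hW.a3'] at hΦ
  refine Eq.trans ?_ hΦ
  rw [hs]
  simp [Φ, PiR_eq_sum hs, TensorProduct.sum_tmul, Finset.sum_mul, Finset.mul_sum,
    TensorProduct.smul_tmul']
  rw [Finset.sum_comm]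

theorem exists_delta_one_eq_sum (hW : IsWeakHopf W) :
    ∃ (s : Finset (H × H)) (y z : H × H → H), (∀ i, IsRightBase W (y i)) ∧
      (∀ i, IsLeftBase W (z i)) ∧ W.δ 1 = ∑ i ∈ s, y i ⊗ₜ[k] z i := by
  obtain ⟨s, hs⟩ := TensorProduct.exists_finset (W.δ 1)
  refine ⟨s, fun i => PiR W i.1, fun i => PiL W i.2, fun i => isRightBase_PiR hW _,
    fun i => isLeftBase_PiL hW _, ?_⟩
  rw [← lTensor_PiL_delta_one hW, ← rTensor_PiR_delta_one hW, hs]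
  simp

theorem IsRightBase.PiR_eq (hW : IsWeakHopf W) {y : H} (hy : IsRightBase W y) :
    PiR W y = y := by
  obtain ⟨s, hs⟩ := TensorProduct.exists_finset (W.δ 1)
  have := hW.counit_right y
  rw [hy.left, hs] at this
  simpa [PiR_eq_sum hs, Finset.mul_sum] using this

theorem PiL_eq_conv (hW : IsWeakHopf W) : conv k W.δ LinearMap.id W.lam = PiL W := by
  ext h
  exact hW.a4_left h

theorem PiR_eq_conv (hW : IsWeakHopf W) : conv k W.δ W.lam LinearMap.id = PiR W := by
  ext h
  exact hW.a4_right h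

theorem PiR_conv_lam (hW : IsWeakHopf W) : conv k W.δ (PiR W) W.lam = W.lam := by
  rw [← PiR_eq_conv hW, hW.a4_mid]

theorem lam_conv_PiL (hW : IsWeakHopf W) : conv k W.δ W.lam (PiL W) = W.lam := by
  rw [← PiL_eq_conv hW, ← conv_assoc hW, hW.a4_mid]

theorem IsLeftBase.mul_PiL (hW : IsWeakHopf W) {z : H} (hz : IsLeftBase W z) (h : H) :
    PiL W (z * h) = z * PiL W h := by
  obtain ⟨s, hs⟩ := TensorProduct.exists_finset (W.δ h)
  have hs' : W.δ (z * h) = ∑ i ∈ s, (z * i.1) ⊗ₜ[k] i.2 := by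
    simp [hz.delta_mul hW, hs, Finset.mul_sum]
  rw [← PiL_eq_conv hW, conv_eq_sum _ _ hs, conv_eq_sum _ _ hs']
  simp [Finset.mul_sum, mul_assoc]

theorem IsRightBase.lam_eq (hW : IsWeakHopf W) {y : H} (hy : IsRightBase W y) :
    W.lam y = PiL W y := by
  obtain ⟨s, r, z, hr, -, hs⟩ := exists_delta_one_eq_sum hW
  have hs' : W.δ y = ∑ i ∈ s, r i ⊗ₜ[k] (y * z i) := by
    simp [hy.left, hs, Finset.mul_sum]
  rw [← PiR_conv_lam hW, ← PiL_eq_conv hW, conv_eq_sum _ _ hs', conv_eq_sum _ _ hs']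
  simp [(hr _).PiR_eq hW]

theorem lTensor_PiL_delta (hW : IsWeakHopf W) (h : H) :
    LinearMap.lTensor H (PiL W) (W.δ h) = W.δ 1 * (h ⊗ₜ[k] 1) := by
  obtain ⟨s, y, z, hy, -, hs⟩ := exists_delta_one_eq_sum hW
  obtain ⟨t, ht⟩ := TensorProduct.exists_finset (W.δ h)
  have key : ∀ i, y i * h = ∑ j ∈ t, W.ε (y i * j.2) • j.1 := by
    intro i
    have := hW.counit_right (y i * h)
    rw [(hy i).delta_mul hW, ht] at this
    simpa [Finset.mul_sum] using this.symm
  rw [ht, hs]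
  simp [PiL_eq_sum hs, Finset.sum_mul, key, TensorProduct.sum_tmul, TensorProduct.tmul_sum,
    TensorProduct.smul_tmul', TensorProduct.tmul_smul]
  rw [Finset.sum_comm]

theorem IsRightBase.delta_mul_lam (hW : IsWeakHopf W) {y : H} (hy : IsRightBase W y) (h : H) :
    W.δ h * (1 ⊗ₜ[k] W.lam y) = W.δ h * (y ⊗ₜ[k] 1) := by
  obtain ⟨s, r, z, -, hz, hs⟩ := exists_delta_one_eq_sum hW
  have hone : W.δ 1 * (1 ⊗ₜ[k] W.lam y) = W.δ 1 * (y ⊗ₜ[k] 1) := by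
    rw [← lTensor_PiL_delta hW, hy.right, hs, hy.lam_eq hW]
    simp [Finset.sum_mul, (hz _).mul_PiL hW]
  rw [← delta_mul_one hW h, mul_assoc, hone, mul_assoc]

theorem IsLeftBase.mul_lam (hW : IsWeakHopf W) {z : H} (hz : IsLeftBase W z) :
    LinearMap.mulLeft k z ∘ₗ W.lam = conv k W.δ W.lam
      (Algebra.linearMap k H ∘ₗ W.ε ∘ₗ LinearMap.mulRight k z) := by
  have hX : PiL W ∘ₗ LinearMap.mulRight k z =
      conv k W.δ (LinearMap.mulRight k z) W.lam := by
    ext h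
    obtain ⟨s, hs⟩ := TensorProduct.exists_finset (W.δ h)
    have hs' : W.δ (h * z) = ∑ i ∈ s, (i.1 * z) ⊗ₜ[k] i.2 := by
      simp [hz.delta_mul' hW, hs, Finset.sum_mul]
    rw [← PiL_eq_conv hW, conv_eq_sum _ _ hs]
    simp [conv_eq_sum _ _ hs']
  have hE : PiL W ∘ₗ LinearMap.mulRight k z = conv k W.δ (PiL W)
      (Algebra.linearMap k H ∘ₗ W.ε ∘ₗ LinearMap.mulRight k z) := by
    ext h
    obtain ⟨s, hs⟩ := TensorProduct.exists_finset (W.δ h)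
    obtain ⟨t, ht⟩ := TensorProduct.exists_finset (W.δ 1)
    have key : ∀ x, W.ε (x * (h * z)) = ∑ i ∈ s, W.ε (x * i.1) * W.ε (i.2 * z) := by
      intro x
      rw [← mul_assoc, hW.a2, hs]
      simp
    rw [conv_eq_sum _ _ hs]
    simp only [LinearMap.comp_apply, LinearMap.mulRight_apply, PiL_eq_sum ht, key,
      Finset.sum_smul, Algebra.linearMap_apply, ← Algebra.commutes, ← Algebra.smul_def,
      Finset.smul_sum, smul_smul]
    rw [Finset.sum_comm]
    simp only [mul_comm]
  have hR : conv k W.δ W.lam (LinearMap.mulRight k z) = LinearMap.mulLeft k z ∘ₗ PiR W := by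
    have := mulRight_comp_conv W.δ z W.lam LinearMap.id
    rw [LinearMap.comp_id] at this
    rw [this, PiR_eq_conv hW]
    ext h
    simp [(isRightBase_PiR hW h).commute hW hz]
  rw [← lam_conv_PiL hW, conv_assoc hW, ← hE, hX, ← conv_assoc hW, hR, mulLeft_comp_conv,
    PiR_conv_lam hW, lam_conv_PiL hW]

end WeakHopf

section ComoduleAlgebra

variable {A : Type} [Ring A] [Algebra k A] {W : HopfData k H} {ρ : A →ₗ[k] A ⊗[k] H}

theorem coact_mul_coact_one (hρ : IsComodAlg W ρ) (a : A) : ρ a * ρ 1 = ρ a := by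
  rw [← hρ.mul_compat, mul_one]

theorem coact_one_mul_coact (hρ : IsComodAlg W ρ) (a : A) : ρ 1 * ρ a = ρ a := by
  rw [← hρ.mul_compat, one_mul]

theorem exists_coact_one_eq_sum (hW : IsWeakHopf W) (hρ : IsComodAlg W ρ) :
    ∃ (s : Finset (A × H)) (a : A × H → A) (z : A × H → H), (∀ i, IsLeftBase W (z i)) ∧
      ρ 1 = ∑ i ∈ s, a i ⊗ₜ[k] z i := by
  obtain ⟨s, hs⟩ := TensorProduct.exists_finset (ρ 1)
  refine ⟨s, fun i => i.1, fun i => PiL W i.2, fun i => isLeftBase_PiL hW _, ?_⟩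
  rw [← hρ.unit_coinv, hs]
  simp

theorem coact_eGen (hW : IsWeakHopf W) (hρ : IsComodAlg W ρ) (h : H) :
    ρ (eGen W (ρ 1) h) = ρ 1 * (1 ⊗ₜ[k] PiR W h) := by
  obtain ⟨s, a, z, hz, hs⟩ := exists_coact_one_eq_sum hW hρ
  obtain ⟨t, ht⟩ := TensorProduct.exists_finset (W.δ 1)
  let Φ : A ⊗[k] (H ⊗[k] H) →ₗ[k] A ⊗[k] H :=
    LinearMap.lTensor A ((TensorProduct.rid k _).toLinearMap ∘ₗ
      LinearMap.lTensor _ (W.ε ∘ₗ LinearMap.mulLeft k h))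
  have formal : ∀ t : A ⊗[k] H, ∀ x : H, Φ (TensorProduct.assoc k A H H (t ⊗ₜ[k] x)) =
      W.ε (h * x) • t := by
    intro t x
    induction t with
    | zero => simp
    | add a b ha hb => simp only [TensorProduct.add_tmul, map_add, ha, hb, smul_add]
    | tmul a b => simp [Φ]
  have hl : ρ (eGen W (ρ 1) h) =
      Φ (TensorProduct.assoc k A H H (LinearMap.rTensor H ρ (ρ 1))) := by
    rw [eGen_eq_sum hs]
    conv_rhs => rw [hs]
    simp [formal]
  rw [hl, hρ.coassoc, hs, PiR_eq_sum ht]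
  simp [Φ, (hz _).left, ht, TensorProduct.tmul_sum, Finset.sum_mul, Finset.mul_sum,
    Finset.smul_sum]
  rw [Finset.sum_comm]

theorem coact_eGen' (hW : IsWeakHopf W) (hρ : IsComodAlg W ρ) (h : H) :
    ρ (eGen W (ρ 1) h) = (1 ⊗ₜ[k] PiR W h) * ρ 1 := by
  obtain ⟨s, a, z, hz, hs⟩ := exists_coact_one_eq_sum hW hρ
  rw [coact_eGen hW hρ, hs]
  simp [Finset.sum_mul, Finset.mul_sum, (isRightBase_PiR hW h).commute hW (hz _)]

theorem eGen_PiR (hW : IsWeakHopf W) (hρ : IsComodAlg W ρ) (h : H) :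
    eGen W (ρ 1) (PiR W h) = eGen W (ρ 1) h := by
  obtain ⟨s, hs⟩ := TensorProduct.exists_finset (ρ 1)
  have := hρ.counit (eGen W (ρ 1) h)
  rw [coact_eGen' hW hρ, hs] at this
  rw [eGen_eq_sum hs, hs, ← this]
  simp [Finset.mul_sum]

theorem eGen_one (hρ : IsComodAlg W ρ) : eGen W (ρ 1) 1 = 1 := by
  obtain ⟨s, hs⟩ := TensorProduct.exists_finset (ρ 1)
  have := hρ.counit 1
  rw [hs] at this
  simpa [eGen_eq_sum hs] using this

theorem dGen_one (hρ : IsComodAlg W ρ) : dGen W (ρ 1) 1 = 1 := by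
  obtain ⟨s, hs⟩ := TensorProduct.exists_finset (ρ 1)
  have := hρ.counit 1
  rw [hs] at this
  simpa [dGen_eq_sum hs] using this

theorem IsRightBase.dGen_eq_eGen (hW : IsWeakHopf W) (hρ : IsComodAlg W ρ) {y : H}
    (hy : IsRightBase W y) : dGen W (ρ 1) y = eGen W (ρ 1) y := by
  obtain ⟨s, a, z, hz, hs⟩ := exists_coact_one_eq_sum hW hρ
  simp [dGen_eq_sum hs, eGen_eq_sum hs, hy.commute hW (hz _)]

theorem rTensor_eGen_delta_one (hρ : IsComodAlg W ρ) :
    LinearMap.rTensor H (eGen W (ρ 1)) (W.δ 1) = ρ 1 := by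
  obtain ⟨s, hs⟩ := TensorProduct.exists_finset (W.δ 1)
  obtain ⟨t, ht⟩ := TensorProduct.exists_finset (ρ 1)
  refine Eq.trans ?_ hρ.unit_coinv
  rw [ht, hs]
  simp [eGen_eq_sum rfl, PiL_eq_sum hs, TensorProduct.sum_tmul, TensorProduct.tmul_sum,
    TensorProduct.smul_tmul', TensorProduct.tmul_smul]
  rw [Finset.sum_comm]

theorem rTensor_eGen_delta (hW : IsWeakHopf W) (hρ : IsComodAlg W ρ) (h : H) :
    LinearMap.rTensor H (eGen W (ρ 1)) (W.δ h) = (1 ⊗ₜ[k] h) * ρ 1 := by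
  obtain ⟨s, a, z, hz, hs⟩ := exists_coact_one_eq_sum hW hρ
  obtain ⟨t, ht⟩ := TensorProduct.exists_finset (W.δ h)
  have key : ∀ i, h * z i = ∑ j ∈ t, W.ε (j.1 * z i) • j.2 := by
    intro i
    have := hW.counit_left (h * z i)
    rw [(hz i).delta_mul' hW, ht] at this
    simpa [Finset.sum_mul] using this.symm
  rw [ht, map_sum]
  simp only [LinearMap.rTensor_tmul, eGen_eq_sum hs]
  rw [hs]
  simp [Finset.mul_sum, key, TensorProduct.sum_tmul, TensorProduct.tmul_sum,
    TensorProduct.smul_tmul', TensorProduct.tmul_smul]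
  rw [Finset.sum_comm]

section Integral

variable {f : H →ₗ[k] A}

theorem IsIntegral.mul_eGen (hW : IsWeakHopf W) (hρ : IsComodAlg W ρ) (hf : IsIntegral W ρ f)
    {y : H} (hy : IsRightBase W y) (h : H) : f (h * y) = f h * eGen W (ρ 1) y := by
  obtain ⟨s, hs⟩ := TensorProduct.exists_finset (W.δ h)
  rw [← hρ.counit (f (h * y)), ← hρ.counit (f h * _), hf, hρ.mul_compat, coact_eGen hW hρ,
    ← mul_assoc, coact_mul_coact_one hρ, hf, hy.PiR_eq hW, hy.delta_mul' hW, hs]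
  simp [Finset.sum_mul]

theorem IsIntegral.eGen_mul (hW : IsWeakHopf W) (hρ : IsComodAlg W ρ) (hf : IsIntegral W ρ f)
    {y : H} (hy : IsRightBase W y) (h : H) : f (y * h) = eGen W (ρ 1) y * f h := by
  obtain ⟨s, hs⟩ := TensorProduct.exists_finset (W.δ h)
  rw [← hρ.counit (f (y * h)), ← hρ.counit (_ * f h), hf, hρ.mul_compat, coact_eGen' hW hρ,
    mul_assoc, coact_one_mul_coact hρ, hf, hy.PiR_eq hW, hy.delta_mul hW, hs]
  simp [Finset.mul_sum]

theorem IsIntegral.map_one_commute_eGen (hW : IsWeakHopf W) (hρ : IsComodAlg W ρ)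
    (hf : IsIntegral W ρ f) (h : H) : f 1 * eGen W (ρ 1) h = eGen W (ρ 1) h * f 1 := by
  have hy := isRightBase_PiR hW h
  rw [← eGen_PiR hW hρ, ← hf.mul_eGen hW hρ hy, ← hf.eGen_mul hW hρ hy, one_mul, mul_one]

theorem IsIntegral.map_PiL_delta (hW : IsWeakHopf W) (hρ : IsComodAlg W ρ)
    (hf : IsIntegral W ρ f) (h : H) :
    TensorProduct.map f (PiL W) (W.δ h) = ρ 1 * (f h ⊗ₜ[k] 1) := by
  obtain ⟨s, y, z, hy, -, hs⟩ := exists_delta_one_eq_sum hW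
  have : TensorProduct.map f (PiL W) (W.δ h) =
      LinearMap.rTensor H f (LinearMap.lTensor H (PiL W) (W.δ h)) := by
    rw [← LinearMap.comp_apply (LinearMap.rTensor H f), LinearMap.rTensor_comp_lTensor]
  rw [this, lTensor_PiL_delta hW, ← rTensor_eGen_delta_one hρ, hs]
  simp [Finset.sum_mul, hf.eGen_mul hW hρ (hy _)]

end Integral

section Cleaving

variable {f finv : H →ₗ[k] A}

theorem conv_includeLeft_includeRight (f : H →ₗ[k] A) (g : H →ₗ[k] H) (h : H) :
    conv k W.δ ((Algebra.TensorProduct.includeLeft : A →ₐ[k] A ⊗[k] H).toLinearMap ∘ₗ f)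
      ((Algebra.TensorProduct.includeRight : H →ₐ[k] A ⊗[k] H).toLinearMap ∘ₗ g) h =
      TensorProduct.map f g (W.δ h) := by
  obtain ⟨s, hs⟩ := TensorProduct.exists_finset (W.δ h)
  simp [conv_eq_sum _ _ hs, hs]

theorem conv_includeRight_includeLeft (f : H →ₗ[k] A) (g : H →ₗ[k] H) (h : H) :
    conv k W.δ ((Algebra.TensorProduct.includeRight : H →ₐ[k] A ⊗[k] H).toLinearMap ∘ₗ g)
      ((Algebra.TensorProduct.includeLeft : A →ₐ[k] A ⊗[k] H).toLinearMap ∘ₗ f) h =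
      TensorProduct.map f g (TensorProduct.comm k H H (W.δ h)) := by
  obtain ⟨s, hs⟩ := TensorProduct.exists_finset (W.δ h)
  simp [conv_eq_sum _ _ hs, hs]

/-- The coaction on the convolution inverse of a cleaving morphism:
`ρ (f⁻¹ h) = f⁻¹(h₂) ⊗ λ(h₁)`. -/
theorem IsCleaving.coact_finv (hW : IsWeakHopf W) (hρ : IsComodAlg W ρ)
    (hf : IsCleaving W ρ f finv) (h : H) :
    ρ (finv h) = TensorProduct.map finv W.lam (TensorProduct.comm k H H (W.δ h)) := by
  obtain ⟨hint, ⟨hc₁, hc₂, hc₃⟩, hcoinv⟩ := hf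
  let L : A →ₗ[k] A ⊗[k] H := (Algebra.TensorProduct.includeLeft : A →ₐ[k] A ⊗[k] H).toLinearMap
  let R : H →ₗ[k] A ⊗[k] H := (Algebra.TensorProduct.includeRight : H →ₐ[k] A ⊗[k] H).toLinearMap
  have hL : ∀ a b, L (a * b) = L a * L b := fun a b => by simp [L]
  have hR : ∀ a b, R (a * b) = R a * R b := fun a b => by simp [R]
  set G := conv k W.δ (R ∘ₗ W.lam) (L ∘ₗ finv) with hG
  have hF : ρ ∘ₗ f = conv k W.δ (L ∘ₗ f) (R ∘ₗ LinearMap.id) := by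
    ext x
    rw [conv_includeLeft_includeRight]
    exact hint x
  have hFG : conv k W.δ (ρ ∘ₗ f) G = conv k W.δ (ρ ∘ₗ f) (ρ ∘ₗ finv) := by
    have hLP : conv k W.δ (L ∘ₗ f) (R ∘ₗ PiL W) = LinearMap.mulLeft k (ρ 1) ∘ₗ L ∘ₗ f := by
      ext x
      rw [conv_includeLeft_includeRight, hint.map_PiL_delta hW hρ]
      simp [L]
    rw [hF, hG, conv_assoc hW, ← conv_assoc hW (R ∘ₗ LinearMap.id), comp_conv _ R hR,
      PiL_eq_conv hW, ← conv_assoc hW, hLP, mulLeft_comp_conv, comp_conv _ L hL, ← hF,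
      comp_conv _ ρ hρ.mul_compat]
    ext x
    simpa [L, IsCoinv, zeta] using (hcoinv x).symm
  have hGF : conv k W.δ G (ρ ∘ₗ f) = ρ ∘ₗ eGen W (ρ 1) := by
    have hLe : conv k W.δ (L ∘ₗ eGen W (ρ 1)) (R ∘ₗ LinearMap.id) =
        LinearMap.mulRight k (ρ 1) ∘ₗ R ∘ₗ LinearMap.id := by
      ext x
      rw [conv_includeLeft_includeRight]
      exact rTensor_eGen_delta hW hρ x
    rw [hF, hG, conv_assoc hW, ← conv_assoc hW (L ∘ₗ finv), comp_conv _ L hL, hc₁, hLe,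
      mulRight_comp_conv, comp_conv _ R hR, PiR_eq_conv hW]
    ext x
    simpa [R] using (coact_eGen' hW hρ x).symm
  have hρe : ρ ∘ₗ eGen W (ρ 1) = LinearMap.mulLeft k (ρ 1) ∘ₗ R ∘ₗ PiR W := by
    ext x
    simpa [R] using coact_eGen hW hρ x
  have hlam : LinearMap.mulLeft k (ρ 1) ∘ₗ R ∘ₗ W.lam =
      conv k W.δ (R ∘ₗ W.lam) (L ∘ₗ eGen W (ρ 1)) := by
    obtain ⟨s, a, z, hz, hs⟩ := exists_coact_one_eq_sum hW hρ
    ext x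
    obtain ⟨t, ht⟩ := TensorProduct.exists_finset (W.δ x)
    have key : ∀ i, z i * W.lam x = ∑ j ∈ t, W.ε (j.2 * z i) • W.lam j.1 := by
      intro i
      have := LinearMap.congr_fun ((hz i).mul_lam hW) x
      rw [conv_eq_sum _ _ ht] at this
      simpa [← Algebra.commutes, ← Algebra.smul_def] using this
    rw [conv_eq_sum _ _ ht]
    simp only [LinearMap.comp_apply, eGen_eq_sum hs]
    rw [hs]
    simp [L, R, Finset.sum_mul, Finset.mul_sum, key, TensorProduct.tmul_sum]
    rw [Finset.sum_comm]
  have hGFG : conv k W.δ (conv k W.δ G (ρ ∘ₗ f)) G = G := by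
    rw [hGF, hρe, mulLeft_comp_conv, hG, ← conv_assoc hW, comp_conv _ R hR, PiR_conv_lam hW,
      ← mulLeft_comp_conv, hlam, conv_assoc hW, comp_conv _ L hL, ← hc₁, hc₃]
  have hρfinv : ρ ∘ₗ finv = G := by
    calc ρ ∘ₗ finv
        = conv k W.δ (conv k W.δ (ρ ∘ₗ finv) (ρ ∘ₗ f)) (ρ ∘ₗ finv) := by
          rw [comp_conv _ ρ hρ.mul_compat, comp_conv _ ρ hρ.mul_compat, hc₃]
      _ = conv k W.δ (conv k W.δ (ρ ∘ₗ finv) (ρ ∘ₗ f)) G := by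
          rw [conv_assoc hW, ← hFG, ← conv_assoc hW]
      _ = conv k W.δ (conv k W.δ G (ρ ∘ₗ f)) G := by
          rw [comp_conv _ ρ hρ.mul_compat, hc₁, hGF]
      _ = G := hGFG
  rw [← conv_includeRight_includeLeft, ← LinearMap.comp_apply, hρfinv]

theorem IsCleaving.sum_mul_finv (hW : IsWeakHopf W) (hρ : IsComodAlg W ρ)
    (hf : IsCleaving W ρ f finv) {ι : Type} {s : Finset ι} {y z : ι → H}
    (hy : ∀ i, IsRightBase W (y i)) (hs : W.δ 1 = ∑ i ∈ s, y i ⊗ₜ[k] z i) (h : H) :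
    ∑ i ∈ s, f (h * y i) * finv (z i) = f h * finv 1 := by
  obtain ⟨hint, ⟨hc₁, -, hc₃⟩, -⟩ := hf
  have := LinearMap.congr_fun hc₃ 1
  rw [hc₁, conv_eq_sum _ _ hs] at this
  simp [hint.mul_eGen hW hρ (hy _), mul_assoc, ← this, Finset.mul_sum]

theorem IsCleaving.map_one_mul_finv_one (hW : IsWeakHopf W) (hρ : IsComodAlg W ρ)
    (hf : IsCleaving W ρ f finv) : f 1 * finv 1 = 1 := by
  obtain ⟨s, y, z, hy, -, hs⟩ := exists_delta_one_eq_sum hW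
  rw [← hf.sum_mul_finv hW hρ hy hs, ← dGen_one hρ, ← hf.2.1.2.1, conv_eq_sum _ _ hs]
  simp

theorem IsCleaving.isIntegral_mulRight (hW : IsWeakHopf W) (hρ : IsComodAlg W ρ)
    (hf : IsCleaving W ρ f finv) : IsIntegral W ρ (LinearMap.mulRight k (finv 1) ∘ₗ f) := by
  intro h
  obtain ⟨s, y, z, hy, -, hs⟩ := exists_delta_one_eq_sum hW
  obtain ⟨t, ht⟩ := TensorProduct.exists_finset (W.δ h)
  have key : ∀ i, LinearMap.rTensor H f (W.δ h) * (finv (z i) ⊗ₜ[k] W.lam (y i)) =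
      ∑ j ∈ t, (f (j.1 * y i) * finv (z i)) ⊗ₜ[k] j.2 := by
    intro i
    have h₁ : LinearMap.rTensor H f (W.δ h) * (finv (z i) ⊗ₜ[k] W.lam (y i)) =
        LinearMap.rTensor H f (W.δ h * (1 ⊗ₜ[k] W.lam (y i))) * (finv (z i) ⊗ₜ[k] 1) := by
      simp [ht, Finset.sum_mul]
    rw [h₁, (hy i).delta_mul_lam hW, ht]
    simp [Finset.sum_mul]
  have h₂ : ρ (f h * finv 1) = ∑ i ∈ s, ∑ j ∈ t, (f (j.1 * y i) * finv (z i)) ⊗ₜ[k] j.2 := by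
    rw [hρ.mul_compat, hf.coact_finv hW hρ, hf.1, hs]
    simp [Finset.mul_sum, key]
  simp only [LinearMap.comp_apply, LinearMap.mulRight_apply]
  rw [h₂, Finset.sum_comm, ht]
  simp [← TensorProduct.sum_tmul, hf.sum_mul_finv hW hρ hy hs]

theorem IsCleaving.finv_one_mul_map_one (hW : IsWeakHopf W) (hρ : IsComodAlg W ρ)
    (hf : IsCleaving W ρ f finv) (hcoc : Cocomm W) : finv 1 * f 1 = 1 := by
  obtain ⟨hint, ⟨hc₁, hc₂, hc₃⟩, -⟩ := hf
  obtain ⟨s, y, z, hy, -, hs⟩ := exists_delta_one_eq_sum hW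
  have hs' : W.δ 1 = ∑ i ∈ s, z i ⊗ₜ[k] y i := by
    rw [← hcoc 1, hs]
    simp
  have hb : finv 1 = ∑ i ∈ s, finv (z i) * eGen W (ρ 1) (y i) := by
    conv_lhs => rw [← hc₃, conv_assoc hW, hc₂, conv_eq_sum _ _ hs']
    simp [(hy _).dGen_eq_eGen hW hρ]
  have hone := LinearMap.congr_fun hc₁ 1
  rw [eGen_one hρ, conv_eq_sum _ _ hs'] at hone
  rw [hb, Finset.sum_mul]
  simpa only [mul_assoc, ← hint.eGen_mul hW hρ (hy _), mul_one] using hone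

end Cleaving

end ComoduleAlgebra

/-- Let `H` be a weak Hopf algebra whose antipode is
bijective and `A_H ↪ A` an `H`-cleft extension with cleaving morphism `f`.
Then `h = μ_A∘(f⊗(f⁻¹∘η_H))` is a total integral, and if moreover `H` is
cocommutative, `h` is convolution invertible with convolution inverse
`h⁻¹ = μ_A∘((f∘η_H)⊗f⁻¹)`. -/
theorem statement4 {k H A : Type} [CommRing k] [Ring H] [Algebra k H]
    [Ring A] [Algebra k A]
    (W : HopfData k H) (hW : IsWeakHopf W) (hlam : Function.Bijective W.lam)
    (ρ : A →ₗ[k] A ⊗[k] H) (hρ : IsComodAlg W ρ)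
    (f finv : H →ₗ[k] A) (hf : IsCleaving W ρ f finv) :
    IsIntegral W ρ (LinearMap.mulRight k (finv 1) ∘ₗ f) ∧
    (LinearMap.mulRight k (finv 1) ∘ₗ f) 1 = 1 ∧
    (Cocomm W →
      IsConvInv W ρ (LinearMap.mulRight k (finv 1) ∘ₗ f)
        (LinearMap.mulLeft k (f 1) ∘ₗ finv)) := by
  have hab := hf.map_one_mul_finv_one hW hρ
  refine ⟨hf.isIntegral_mulRight hW hρ, by simpa using hab, fun hcoc => ?_⟩
  have hba := hf.finv_one_mul_map_one hW hρ hcoc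
  obtain ⟨hint, ⟨hc₁, hc₂, hc₃⟩, -⟩ := hf
  have he : conv k W.δ (LinearMap.mulLeft k (f 1) ∘ₗ finv)
      (LinearMap.mulRight k (finv 1) ∘ₗ f) = eGen W (ρ 1) := by
    rw [mulLeft_comp_conv, mulRight_comp_conv, hc₁]
    ext x
    simp only [LinearMap.comp_apply, LinearMap.mulRight_apply, LinearMap.mulLeft_apply]
    rw [← mul_assoc, hint.map_one_commute_eGen hW hρ, mul_assoc, hab, mul_one]
  refine ⟨he, ?_, ?_⟩
  · rw [← hc₂]
    ext x
    obtain ⟨s, hs⟩ := TensorProduct.exists_finset (W.δ x)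
    rw [conv_eq_sum _ _ hs, conv_eq_sum _ _ hs]
    refine Finset.sum_congr rfl fun i _ => ?_
    simp only [LinearMap.comp_apply, LinearMap.mulRight_apply, LinearMap.mulLeft_apply]
    rw [mul_assoc, ← mul_assoc (finv 1), hba, one_mul]
  · rw [he]
    ext x
    obtain ⟨s, hs⟩ := TensorProduct.exists_finset (W.δ x)
    have hx := LinearMap.congr_fun hc₃ x
    rw [hc₁, conv_eq_sum _ _ hs] at hx
    rw [conv_eq_sum _ _ hs]
    simp only [LinearMap.comp_apply, LinearMap.mulLeft_apply, ← mul_assoc,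
      ← hint.map_one_commute_eGen hW hρ]
    simp only [mul_assoc, ← Finset.mul_sum, hx]

end WHA

end
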